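/- Let X be a normal random variable with mean μ and variance σ² > 0, let n ≥ 1 be an integer, and let g : ℝ → ℝ be (n−1)-times continuously differentiable with g^{(n−1)} absolutely continuous (a.e. derivative g^{(n)}) and E[(g^{(n)}(X))²] < ∞. Then (−1)^n (Var[g(X)] − Σ_{k=1}^{n} (−1)^{k−1} (σ^{2k}/k!) E[(g^{(k)}(X))²]) ≥ 0. -/

import Mathlib

open MeasureTheory ProbabilityTheory Finset Filter

noncomputable section

/-- Falling factorial `(x)_k = x (x-1) ⋯ (x-k+1)`, with `(x)_0 = 1`. -/
def fall (x : ℝ) (k : ℕ) : ℝ := ∏ j ∈ Finset.range k, (x - j)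

/-- Rising factorial `[x]_k = x (x+1) ⋯ (x+k-1)`, with `[x]_0 = 1`. -/
def rise (x : ℝ) (k : ℕ) : ℝ := ∏ j ∈ Finset.range k, (x + j)

/-- The product `∏_{j=a}^{a+len-1} (1 - j δ)` of `len` consecutive factors
(an empty product is `1`). -/
def pp (δ a : ℝ) (len : ℕ) : ℝ := ∏ j ∈ Finset.range len, (1 - (a + j) * δ)

/-- The open real interval with (possibly infinite) endpoints `α ω : EReal`. -/
def erealIoo (α ω : EReal) : Set ℝ := {x : ℝ | α < (x : EReal) ∧ (x : EReal) < ω}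

/-- `g` coincides on `J` with a polynomial of degree at most `d`. -/
def IsPolyOn (g : ℝ → ℝ) (J : Set ℝ) (d : ℕ) : Prop :=
  ∃ p : Polynomial ℝ, p.natDegree ≤ d ∧ ∀ x ∈ J, g x = p.eval x

/-- The quadratic `q(x) = δ x² + β x + γ` of a Pearson family. -/
def pq (δ β γ : ℝ) : ℝ → ℝ := fun x => δ * x ^ 2 + β * x + γ

/-- `P` is the distribution of a random variable with density `f` (w.r.t. Lebesgue
measure) belonging to the integrated Pearson family `IP(μ; δ, β, γ)`:
`μ` is the (finite) mean of `P`, `|δ|+|β|+|γ| > 0`, and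
`∫_{-∞}^x (μ - t) f(t) dt = q(x) f(x)` for all `x`. -/
def IsIntegratedPearson (P : Measure ℝ) (f : ℝ → ℝ) (μ δ β γ : ℝ) : Prop :=
  IsProbabilityMeasure P ∧
  (∀ x, 0 ≤ f x) ∧
  P = volume.withDensity (fun x => ENNReal.ofReal (f x)) ∧
  Integrable (fun x : ℝ => x) P ∧
  μ = ∫ x, x ∂P ∧
  0 < |δ| + |β| + |γ| ∧
  ∀ x : ℝ, (∫ t in Set.Iic x, (μ - t) * f t) = pq δ β γ x * f x

/-- Membership in the class `H^{m,n}(X)` for the distribution `P` of `X` with Pearson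
quadratic `q` and support `J`.  Here `gd k` plays the role of the `k`-th derivative
`g^{(k)}` of `g = gd 0` on `J`.  With `ℓ = max m n`:  `g ∈ C^{ℓ-1}(J)`
(encoded by `gd k` having derivative `gd (k+1)` at every point of `J` for `k+1 < ℓ`,
and `gd (ℓ-1)` continuous on `J`), `g^{(ℓ-1)}` is absolutely continuous on `J` with
a.e. derivative `g^{(ℓ)} = gd ℓ` (encoded by the fundamental theorem of calculus:
`gd ℓ` is locally integrable and `gd (ℓ-1)` is its integral on every subinterval of `J`),
and the moment conditions `E[q(X)^n (g^{(n)}(X))²] < ∞` and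
`E[q(X)^i |g^{(i)}(X)|] < ∞` for `n < i ≤ m` hold. -/
def MemH (P : Measure ℝ) (q : ℝ → ℝ) (J : Set ℝ) (m n : ℕ) (gd : ℕ → ℝ → ℝ) : Prop :=
  (∀ k, k + 1 < max m n → ∀ x ∈ J, HasDerivAt (gd k) (gd (k + 1) x) x) ∧
  (1 ≤ max m n → ContinuousOn (gd (max m n - 1)) J) ∧
  (1 ≤ max m n → ∀ a ∈ J, ∀ b ∈ J,
    IntervalIntegrable (gd (max m n)) volume a b ∧
      gd (max m n - 1) b - gd (max m n - 1) a = ∫ t in a..b, gd (max m n) t) ∧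
  Integrable (fun x => q x ^ n * (gd n x) ^ 2) P ∧
  ∀ i, n < i → i ≤ m → Integrable (fun x => q x ^ i * |gd i x|) P

/-- The variance bound `S_{m,n}(g)` of Theorem 2.1, for a Pearson distribution `P`
with quadratic `q` and parameter `δ`. -/
def Sbound (P : Measure ℝ) (δ : ℝ) (q : ℝ → ℝ) (m n : ℕ) (gd : ℕ → ℝ → ℝ) : ℝ :=
  (∑ i ∈ Finset.Icc 1 m,
      ((m.choose i : ℝ) * pp δ ((m : ℝ) + i) n /
          (fall ((m : ℝ) + n) i * (∫ x, q x ^ i ∂P) * pp δ ((i : ℝ) - 1) i *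
            pp δ (m : ℝ) n)) *
        (∫ x, q x ^ i * gd i x ∂P) ^ 2) +
    ∑ i ∈ Finset.Icc 1 n,
      (-1 : ℝ) ^ (i - 1) *
          ((n.choose i : ℝ) / (fall ((m : ℝ) + n) i * pp δ (m : ℝ) i)) *
        ∫ x, q x ^ i * (gd i x) ^ 2 ∂P

/-- The density of the normal distribution `N(μ, σ²)`. -/
def normalDensity (μ σ : ℝ) : ℝ → ℝ := fun x =>
  (Real.sqrt (2 * Real.pi) * σ)⁻¹ * Real.exp (-(x - μ) ^ 2 / (2 * σ ^ 2))


/-- `f` is locally absolutely continuous with a.e. derivative `f'`. -/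
def ACd (f f' : ℝ → ℝ) : Prop :=
  ∀ a b, IntervalIntegrable f' volume a b ∧ f b - f a = ∫ t in a..b, f' t

lemma ACd.ibp {f f' q q' : ℝ → ℝ} (hf : ACd f f') (hq : ∀ x, HasDerivAt q (q' x) x)
    (hq' : Continuous q') (a b : ℝ) :
    ∫ x in a..b, f x * q' x = f b * q b - f a * q a - ∫ x in a..b, f' x * q x := by
  have hfeq : f = fun x => f a + ∫ t in a..x, f' t := by
    funext x
    have := (hf a x).2
    linarith
  have hac : AbsolutelyContinuousOnInterval f a b := by
    have h1 := (hf a b).1.absolutelyContinuousOnInterval_intervalIntegral (c := a) (by simp)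
    have h2 : AbsolutelyContinuousOnInterval (fun _ : ℝ => f a) a b :=
      (LipschitzOnWith.absolutelyContinuousOnInterval (K := 0)
        ((LipschitzWith.const (f a)).lipschitzOnWith))
    rw [hfeq]
    exact h2.add h1
  have hdq : deriv q = q' := funext fun x => (hq x).deriv
  have hqac : AbsolutelyContinuousOnInterval q a b := by
    have hc : ContDiff ℝ 1 q := by
      rw [contDiff_one_iff_deriv]
      exact ⟨fun x => (hq x).differentiableAt, by rw [hdq]; exact hq'⟩
    exact hc.contDiffOn.absolutelyContinuousOnInterval
  have := hac.integral_mul_deriv_eq_deriv_mul hqac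
  rw [hdq] at this
  rw [this]
  congr 1
  apply intervalIntegral.integral_congr_ae
  filter_upwards [(hf a b).1.ae_hasDerivAt_integral] with x hx hx'
  have h := hx (Set.uIoc_subset_uIcc hx') a (by simp)
  have h2 : HasDerivAt f (f' x) x := by
    rw [hfeq]
    exact h.const_add _
  rw [h2.deriv]

lemma ACd.continuous {f f' : ℝ → ℝ} (hf : ACd f f') : Continuous f := by
  have hfeq : f = fun x => f 0 + ∫ t in (0:ℝ)..x, f' t := by
    funext x
    have := (hf 0 x).2
    linarith
  rw [hfeq]
  exact continuous_const.add (intervalIntegral.continuous_primitive (fun a b => (hf a b).1) 0)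

lemma cs_interval {f' : ℝ → ℝ} {a b : ℝ} (h1 : IntervalIntegrable f' volume a b)
    (h2 : IntervalIntegrable (fun x => f' x ^ 2) volume a b) :
    (∫ t in a..b, f' t) ^ 2 ≤ (b - a) * ∫ t in a..b, f' t ^ 2 := by
  wlog hab : a ≤ b generalizing a b
  · have := this h1.symm h2.symm (le_of_not_ge hab)
    rw [intervalIntegral.integral_symm b a, intervalIntegral.integral_symm (f := fun t => f' t ^ 2) b a]
    nlinarith
  rcases hab.eq_or_lt with rfl | hlt
  · simp
  set I := ∫ t in a..b, f' t with hI
  set c := I / (b - a) with hc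
  have h0 : 0 ≤ ∫ t in a..b, (f' t - c) ^ 2 :=
    intervalIntegral.integral_nonneg hab fun _ _ => sq_nonneg _
  have e : ∫ t in a..b, (f' t - c) ^ 2 = (∫ t in a..b, f' t ^ 2) - 2 * c * I + c ^ 2 * (b - a) := by
    have : ∀ t, (f' t - c) ^ 2 = (f' t ^ 2 - 2 * c * f' t) + c ^ 2 := fun t => by ring
    simp_rw [this]
    rw [intervalIntegral.integral_add (h2.sub (h1.const_mul _)) (by simp),
      intervalIntegral.integral_sub h2 (h1.const_mul _), intervalIntegral.integral_const_mul]
    simp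
    ring
  have hcI : c * (b - a) = I := by
    rw [hc]; field_simp [sub_ne_zero.mpr hlt.ne']
  have hpos : 0 < b - a := sub_pos.mpr hlt
  rw [e] at h0
  nlinarith

lemma ACd.integral_zero {F F' : ℝ → ℝ} (hF : ACd F F') (h1 : Integrable F) (h2 : Integrable F') :
    ∫ x, F' x = 0 := by
  have ht : Tendsto (fun b => F b) atTop (nhds (F 0 + ∫ x in Set.Ioi 0, F' x)) := by
    have := intervalIntegral_tendsto_integral_Ioi 0 h2.integrableOn tendsto_id
    refine (this.const_add (F 0)).congr fun b => ?_
    rw [id, ← (hF 0 b).2]; ring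
  have hb : Tendsto (fun b => F b) atBot (nhds (F 0 - ∫ x in Set.Iic 0, F' x)) := by
    have := intervalIntegral_tendsto_integral_Iic 0 h2.integrableOn tendsto_id
    refine (this.const_sub (F 0)).congr fun b => ?_
    rw [id, ← (hF b 0).2]; ring
  have z1 := IntegrableAtFilter.eq_zero_of_tendsto (h1.integrableAtFilter _) (by
    intro s hs
    rcases mem_atTop_sets.1 hs with ⟨b, hb⟩
    rw [← top_le_iff, ← Real.volume_Ici (a := b)]
    exact measure_mono hb) ht
  have z2 := IntegrableAtFilter.eq_zero_of_tendsto (h1.integrableAtFilter _) (by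
    intro s hs
    rcases mem_atBot_sets.1 hs with ⟨b, hb⟩
    rw [← top_le_iff, ← Real.volume_Iic (a := b)]
    exact measure_mono hb) hb
  rw [← intervalIntegral.integral_Iic_add_Ioi (b := 0) h2.integrableOn h2.integrableOn]
  linarith

section gauss
variable {μ σ : ℝ}

lemma nd_pos (hσ : 0 < σ) (x : ℝ) : 0 < normalDensity μ σ x := by
  unfold normalDensity; positivity

lemma nd_cont : Continuous (normalDensity μ σ) := by
  unfold normalDensity
  fun_prop

lemma nd_deriv (hσ : 0 < σ) (x : ℝ) :
    HasDerivAt (normalDensity μ σ) (-((x - μ) / σ ^ 2) * normalDensity μ σ x) x := by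
  have h : HasDerivAt (fun x : ℝ => -(x - μ) ^ 2 / (2 * σ ^ 2)) (-((x - μ) / σ ^ 2)) x := by
    have := (((((hasDerivAt_id' x).sub_const μ).fun_pow 2).fun_neg).div_const (2 * σ ^ 2))
    refine this.congr_deriv ?_
    norm_num
    field_simp
  have := (h.exp).const_mul ((Real.sqrt (2 * Real.pi) * σ)⁻¹)
  refine this.congr_deriv ?_
  unfold normalDensity
  ring

/-- The normal law. -/
def nP (μ σ : ℝ) : Measure ℝ := volume.withDensity (fun x => ENNReal.ofReal (normalDensity μ σ x))

lemma nP_eq (hσ : 0 < σ) : nP μ σ = gaussianReal μ (Real.toNNReal (σ ^ 2)) := by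
  have hv : Real.toNNReal (σ ^ 2) ≠ 0 := by
    have : 0 < σ ^ 2 := by positivity
    simpa using hσ.ne'
  rw [gaussianReal_of_var_ne_zero _ hv, nP]
  congr 1
  funext x
  rw [gaussianPDF_def, gaussianPDFReal_def, normalDensity]
  simp only [Real.coe_toNNReal _ (sq_nonneg σ)]
  rw [Real.sqrt_mul (x := 2 * Real.pi) (by positivity), Real.sqrt_sq hσ.le]

lemma nP_prob (hσ : 0 < σ) : IsProbabilityMeasure (nP μ σ) := by
  rw [nP_eq hσ]; infer_instance

lemma nP_integrable (hσ : 0 < σ) {h : ℝ → ℝ} :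
    Integrable h (nP μ σ) ↔ Integrable (fun x => normalDensity μ σ x * h x) := by
  rw [nP, integrable_withDensity_iff_integrable_smul' (by
    exact (nd_cont.measurable).ennreal_ofReal) (by simp)]
  simp [ENNReal.toReal_ofReal (nd_pos hσ _).le]

lemma nP_integral (hσ : 0 < σ) (h : ℝ → ℝ) :
    ∫ x, h x ∂(nP μ σ) = ∫ x, normalDensity μ σ x * h x := by
  rw [nP, integral_withDensity_eq_integral_toReal_smul (by
    exact (nd_cont.measurable).ennreal_ofReal) (by simp)]
  simp [ENNReal.toReal_ofReal (nd_pos hσ _).le]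

lemma nP_exp (hσ : 0 < σ) (t : ℝ) : Integrable (fun x => Real.exp (t * x)) (nP μ σ) := by
  rw [nP_eq hσ]; exact integrable_exp_mul_gaussianReal t

lemma nP_poly_integrable (hσ : 0 < σ) (p : Polynomial ℝ) :
    Integrable (fun x => p.eval x) (nP μ σ) := by
  induction p using Polynomial.induction_on' with
  | add p q hp hq => simp only [Polynomial.eval_add]; exact hp.add hq
  | monomial n a =>
    simp only [Polynomial.eval_monomial]
    apply Integrable.const_mul
    rw [nP_eq hσ]
    have := integrable_pow_of_mem_interior_integrableExpSet (X := id)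
      (μ := gaussianReal μ (Real.toNNReal (σ ^ 2))) (by simp [integrableExpSet_id_gaussianReal]) n
    simpa using this

lemma nP_poly_memLp (hσ : 0 < σ) (p : Polynomial ℝ) :
    MemLp (fun x => p.eval x) 2 (nP μ σ) := by
  rw [memLp_two_iff_integrable_sq p.continuous.aestronglyMeasurable]
  refine (nP_poly_integrable hσ (p ^ 2)).congr (ae_of_all _ fun x => ?_)
  simp only [Polynomial.eval_pow]

lemma ACd.aesm {f f' : ℝ → ℝ} (hf : ACd f f') : AEStronglyMeasurable f' volume := by
  have : LocallyIntegrable f' volume := by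
    rw [locallyIntegrable_iff]
    intro k hk
    obtain ⟨r, hr⟩ := hk.isBounded.subset_closedBall 0
    rw [Real.closedBall_eq_Icc] at hr
    refine IntegrableOn.mono_set ?_ hr
    rcases le_or_gt (0 - r) (0 + r) with h | h
    · exact (intervalIntegrable_iff_integrableOn_Icc_of_le h).1 (hf _ _).1
    · rw [Set.Icc_eq_empty (not_le.2 h)]; simp
  exact this.aestronglyMeasurable

lemma ACd.memLp' {f f' : ℝ → ℝ} (hf : ACd f f') 
    (h2 : Integrable (fun x => f' x ^ 2) (nP μ σ)) : MemLp f' 2 (nP μ σ) := by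
  rwa [memLp_two_iff_integrable_sq]
  exact hf.aesm.mono_ac (withDensity_absolutelyContinuous _ _)

lemma ACd.memLp (hσ : 0 < σ) {f f' : ℝ → ℝ} (hf : ACd f f') (h : MemLp f' 2 (nP μ σ)) :
    MemLp f 2 (nP μ σ) := by
  have := nP_prob (μ := μ) hσ
  have h2 := h.integrable_sq
  have h2' := (nP_integrable hσ).1 h2
  have hii : ∀ a b, IntervalIntegrable (fun x => f' x ^ 2) volume a b := by
    intro a b
    have : IntervalIntegrable (fun x => normalDensity μ σ x * f' x ^ 2) volume a b :=
      h2'.intervalIntegrable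
    have := this.continuousOn_mul (g := fun x => (normalDensity μ σ x)⁻¹)
      (nd_cont.inv₀ fun x => (nd_pos hσ x).ne').continuousOn
    refine this.congr fun x _ => ?_
    have := (nd_pos (μ := μ) hσ x).ne'
    field_simp
  set G : ℝ → ℝ := fun x => ∫ t in μ..x, f' t ^ 2 with hG
  have hGac : ACd G (fun x => f' x ^ 2) := fun a b => ⟨hii a b, by
    rw [hG]; exact intervalIntegral.integral_interval_sub_left (hii _ _) (hii _ _)⟩
  have hGpos : ∀ x, μ ≤ x → 0 ≤ G x := fun x hx =>
    intervalIntegral.integral_nonneg hx fun _ _ => sq_nonneg _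
  have hGneg : ∀ x, x ≤ μ → G x ≤ 0 := fun x hx => by
    rw [hG]; simp only []; rw [intervalIntegral.integral_symm]
    exact neg_nonpos.2 (intervalIntegral.integral_nonneg hx fun _ _ => sq_nonneg _)
  have hGx : ∀ x, 0 ≤ (x - μ) * G x := fun x => by
    rcases le_total μ x with hx | hx
    · exact mul_nonneg (by linarith) (hGpos x hx)
    · exact mul_nonneg_of_nonpos_of_nonpos (by linarith) (hGneg x hx)
  have hGc := hGac.continuous
  have key : Integrable (fun x => (x - μ) * G x) (nP μ σ) := by
    rw [nP_integrable hσ]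
    have hcont : Continuous (fun x => normalDensity μ σ x * ((x - μ) * G x)) :=
      nd_cont.mul ((by fun_prop : Continuous fun x : ℝ => x - μ).mul hGc)
    refine integrable_of_intervalIntegral_norm_bounded (l := atTop) (a := fun i : ℝ => -i)
      (b := fun i => i) (σ ^ 2 * ∫ x, normalDensity μ σ x * f' x ^ 2)
      (fun i => hcont.integrableOn_Ioc) tendsto_neg_atTop_atBot tendsto_id ?_
    filter_upwards [eventually_ge_atTop |μ|] with i hi
    have hi1 : μ ≤ i := (le_abs_self _).trans hi
    have hi2 : -i ≤ μ := by linarith [neg_abs_le μ]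
    have e1 : ∀ x, ‖normalDensity μ σ x * ((x - μ) * G x)‖ =
        -σ ^ 2 * (G x * (-((x - μ) / σ ^ 2) * normalDensity μ σ x)) := fun x => by
      rw [Real.norm_of_nonneg (mul_nonneg (nd_pos hσ x).le (hGx x))]
      field_simp
    simp_rw [e1]
    rw [intervalIntegral.integral_const_mul, hGac.ibp (fun x => nd_deriv hσ x)
      (by have := nd_cont (μ := μ) (σ := σ); fun_prop)]
    have b1 : 0 ≤ G i * normalDensity μ σ i := mul_nonneg (hGpos i hi1) (nd_pos hσ i).le
    have b2 : G (-i) * normalDensity μ σ (-i) ≤ 0 :=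
      mul_nonpos_of_nonpos_of_nonneg (hGneg _ hi2) (nd_pos hσ _).le
    have b3 : ∫ x in -i..i, f' x ^ 2 * normalDensity μ σ x ≤
        ∫ x, normalDensity μ σ x * f' x ^ 2 := by
      rw [intervalIntegral.integral_of_le (hi2.trans hi1)]
      simp_rw [mul_comm (f' _ ^ 2)]
      exact setIntegral_le_integral h2' (ae_of_all _ fun x =>
        mul_nonneg (nd_pos hσ x).le (sq_nonneg _))
    have : 0 < σ ^ 2 := by positivity
    nlinarith
  rw [memLp_two_iff_integrable_sq hf.continuous.aestronglyMeasurable]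
  refine Integrable.mono' (((integrable_const (2 * f μ ^ 2)).add (key.const_mul 2)))
    (hf.continuous.pow 2).aestronglyMeasurable (ae_of_all _ fun x => ?_)
  rw [Real.norm_of_nonneg (sq_nonneg _)]
  have c1 := cs_interval (hf μ x).1 (hii μ x)
  rw [← (hf μ x).2] at c1
  have : f x ^ 2 ≤ 2 * f μ ^ 2 + 2 * (f x - f μ) ^ 2 := by nlinarith [sq_nonneg (f x - 2 * f μ)]
  simp only [Pi.add_apply]
  simp only [hG]
  linarith

/-- Integration by parts against the normal law. -/
lemma ACd.stein (hσ : 0 < σ) {f f' : ℝ → ℝ} (hf : ACd f f') (h : MemLp f' 2 (nP μ σ))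
    (p : Polynomial ℝ) :
    σ ^ 2 * ∫ x, f' x * p.eval x ∂(nP μ σ) = ∫ x, f x *
      ((Polynomial.X - Polynomial.C μ) * p - Polynomial.C (σ ^ 2) *
        Polynomial.derivative p).eval x ∂(nP μ σ) := by
  have hf2 := hf.memLp hσ h
  set r := ((Polynomial.X - Polynomial.C μ) * p - Polynomial.C (σ ^ 2) *
        Polynomial.derivative p) with hr
  have i1 : Integrable (fun x => f' x * p.eval x) (nP μ σ) :=
    h.integrable_mul (nP_poly_memLp hσ p)
  have i2 : Integrable (fun x => f x * r.eval x) (nP μ σ) :=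
    hf2.integrable_mul (nP_poly_memLp hσ r)
  have i3 : Integrable (fun x => f x * p.eval x) (nP μ σ) :=
    hf2.integrable_mul (nP_poly_memLp hσ p)
  set q : ℝ → ℝ := fun x => p.eval x * normalDensity μ σ x with hq
  set q' : ℝ → ℝ := fun x => -(1 / σ ^ 2) * (r.eval x * normalDensity μ σ x) with hq'
  have hqd : ∀ x, HasDerivAt q (q' x) x := fun x => by
    have := (p.hasDerivAt x).mul (nd_deriv (μ := μ) hσ x)
    refine this.congr_deriv ?_
    simp only [hq', hr, Polynomial.eval_sub, Polynomial.eval_mul, Polynomial.eval_X,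
      Polynomial.eval_C]
    field_simp
    ring
  have hq'c : Continuous q' := continuous_const.mul (r.continuous.mul nd_cont)
  have hqc : Continuous q := p.continuous.mul nd_cont
  have hfc := hf.continuous
  have hprod : ACd (fun x => f x * q x) (fun x => f' x * q x + f x * q' x) := by
    intro a b
    have j1 : IntervalIntegrable (fun x => f' x * q x) volume a b :=
      (hf a b).1.mul_continuousOn hqc.continuousOn
    have j2 : IntervalIntegrable (fun x => f x * q' x) volume a b :=
      (hfc.mul hq'c).intervalIntegrable _ _
    refine ⟨j1.add j2, ?_⟩
    rw [intervalIntegral.integral_add j1 j2, hf.ibp hqd hq'c]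
    ring
  rw [nP_integrable hσ] at i1 i2 i3
  have e1 : (fun x => f' x * q x + f x * q' x) = fun x =>
      normalDensity μ σ x * (f' x * p.eval x) +
        (-(1 / σ ^ 2)) * (normalDensity μ σ x * (f x * r.eval x)) := by
    funext x; simp only [hq, hq']; ring
  have z := hprod.integral_zero (i3.congr (ae_of_all _ fun x => by simp only [hq]; ring))
    (by rw [e1]; exact i1.add (i2.const_mul _))
  rw [e1, integral_add i1 (i2.const_mul _), integral_const_mul] at z
  rw [nP_integral hσ, nP_integral hσ]
  have hs : σ ^ 2 ≠ 0 := by positivity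
  generalize (∫ x, normalDensity μ σ x * (f' x * p.eval x)) = A at *
  generalize (∫ x, normalDensity μ σ x * (f x * r.eval x)) = B at *
  field_simp at z
  linarith

end gauss

section herm
variable {μ σ : ℝ}

/-- Monic orthogonal polynomials of the normal law. -/
def HP (μ v : ℝ) : ℕ → Polynomial ℝ
  | 0 => 1
  | k + 1 => (Polynomial.X - Polynomial.C μ) * HP μ v k
      - Polynomial.C v * Polynomial.derivative (HP μ v k)

lemma HP_deriv (μ v : ℝ) (k : ℕ) :
    Polynomial.derivative (HP μ v (k + 1)) = Polynomial.C ((k : ℝ) + 1) * HP μ v k := by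
  induction k with
  | zero => simp [HP]
  | succ k ih =>
    have e : HP μ v (k + 2) = (Polynomial.X - Polynomial.C μ) * HP μ v (k + 1)
      - Polynomial.C v * Polynomial.derivative (HP μ v (k + 1)) := rfl
    rw [e, ih]
    simp only [Polynomial.derivative_sub, Polynomial.derivative_mul, Polynomial.derivative_X,
      Polynomial.derivative_C, ih]
    have e' : HP μ v (k + 1) = (Polynomial.X - Polynomial.C μ) * HP μ v k
      - Polynomial.C v * Polynomial.derivative (HP μ v k) := rfl
    rw [e']
    simp only [Nat.cast_add, Nat.cast_one, Polynomial.C_add, Polynomial.C_1]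
    ring

lemma poly_ACd (p : Polynomial ℝ) :
    ACd (fun x => p.eval x) (fun x => (Polynomial.derivative p).eval x) := fun a b =>
  ⟨(Polynomial.continuous _).intervalIntegrable _ _, by
    rw [intervalIntegral.integral_eq_sub_of_hasDerivAt (fun x _ => p.hasDerivAt x)
      ((Polynomial.continuous _).intervalIntegrable _ _)]⟩

lemma HP_step (hσ : 0 < σ) {f f' : ℝ → ℝ} (hf : ACd f f') (h : MemLp f' 2 (nP μ σ)) (k : ℕ) :
    ∫ x, f x * (HP μ (σ ^ 2) (k + 1)).eval x ∂(nP μ σ) =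
      σ ^ 2 * ∫ x, f' x * (HP μ (σ ^ 2) k).eval x ∂(nP μ σ) :=
  (hf.stein hσ h _).symm

lemma HP_orth (hσ : 0 < σ) (j k : ℕ) :
    ∫ x, (HP μ (σ ^ 2) j).eval x * (HP μ (σ ^ 2) k).eval x ∂(nP μ σ) =
      if j = k then (σ ^ 2) ^ k * (k.factorial : ℝ) else 0 := by
  have := nP_prob (μ := μ) hσ
  have step : ∀ (p : Polynomial ℝ) k, ∫ x, p.eval x * (HP μ (σ ^ 2) (k + 1)).eval x ∂(nP μ σ) =
      σ ^ 2 * ∫ x, (Polynomial.derivative p).eval x * (HP μ (σ ^ 2) k).eval x ∂(nP μ σ) :=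
    fun p k => HP_step hσ (poly_ACd p) (nP_poly_memLp hσ _) k
  induction k generalizing j with
  | zero =>
    cases j with
    | zero => simp [HP]
    | succ j =>
      simp_rw [mul_comm (Polynomial.eval _ (HP μ (σ ^ 2) (j + 1)))]
      rw [step]
      simp [HP]
  | succ k ih =>
    rw [step]
    cases j with
    | zero => simp [HP]
    | succ j =>
      simp_rw [HP_deriv, Polynomial.eval_mul, Polynomial.eval_C, mul_assoc]
      rw [integral_const_mul, ih]
      by_cases h : j = k
      · subst h; simp [Nat.factorial_succ]; ring
      · simp [h]

lemma HP_span (μ v : ℝ) (n : ℕ) :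
    (Polynomial.X : Polynomial ℝ) ^ n ∈ Submodule.span ℝ (Set.range (HP μ v)) := by
  set S := Submodule.span ℝ (Set.range (HP μ v))
  have hk : ∀ k, HP μ v k ∈ S := fun k => Submodule.subset_span ⟨k, rfl⟩
  have hC : ∀ (c : ℝ) p, p ∈ S → Polynomial.C c * p ∈ S := fun c p hp => by
    rw [← Polynomial.smul_eq_C_mul]; exact S.smul_mem c hp
  have hd : ∀ k, Polynomial.derivative (HP μ v k) ∈ S := fun k => by
    cases k with
    | zero => simp [HP]
    | succ k => rw [HP_deriv]; exact hC _ _ (hk k)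
  have hX : ∀ q ∈ S, Polynomial.X * q ∈ S := by
    intro q hq
    induction hq using Submodule.span_induction with
    | mem x hx =>
      obtain ⟨k, rfl⟩ := hx
      have e' : HP μ v (k + 1) = (Polynomial.X - Polynomial.C μ) * HP μ v k
        - Polynomial.C v * Polynomial.derivative (HP μ v k) := rfl
      have : Polynomial.X * HP μ v k = HP μ v (k + 1) + Polynomial.C μ * HP μ v k +
        Polynomial.C v * Polynomial.derivative (HP μ v k) := by rw [e']; ring
      rw [this]
      exact S.add_mem (S.add_mem (hk _) (hC _ _ (hk _))) (hC _ _ (hd _))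
    | zero => simp
    | add x y _ _ hx hy => rw [mul_add]; exact S.add_mem hx hy
    | smul a x _ hx => rw [mul_smul_comm]; exact S.smul_mem _ hx
  induction n with
  | zero => exact hk 0
  | succ n ih => rw [pow_succ']; exact hX _ ih

lemma exp_abs_memLp (hσ : 0 < σ) (t : ℝ) :
    MemLp (fun x => Real.exp (|t * x|)) 2 (nP μ σ) := by
  rw [memLp_two_iff_integrable_sq (by fun_prop)]
  refine Integrable.mono' ((nP_exp hσ (2 * t)).add (nP_exp hσ (-(2 * t)))) (by fun_prop)
    (ae_of_all _ fun x => ?_)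
  rw [Real.norm_of_nonneg (by positivity), ← Real.exp_nat_mul]
  simp only [Pi.add_apply, Nat.cast_ofNat]
  rcases abs_cases (t * x) with ⟨h, _⟩ | ⟨h, _⟩ <;> rw [h]
  · have : 2 * (t * x) = 2 * t * x := by ring
    rw [this]
    linarith [Real.exp_pos (-(2 * t) * x)]
  · have : 2 * -(t * x) = -(2 * t) * x := by ring
    rw [this]
    linarith [Real.exp_pos ((2 * t) * x)]

lemma complete_aux (hσ : 0 < σ) {f : ℝ → ℝ} (hf : MemLp f 2 (nP μ σ))
    (h0 : ∀ n : ℕ, ∫ x, f x * x ^ n ∂(nP μ σ) = 0) (t : ℝ) :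
    ∫ x, (f x : ℂ) * Complex.exp (t * x * Complex.I) ∂(nP μ σ) = 0 := by
  have hs : HasSum (fun n : ℕ => ∫ x, (f x : ℂ) * (((t * x * Complex.I : ℂ)) ^ n / n.factorial)
      ∂(nP μ σ)) (∫ x, (f x : ℂ) * Complex.exp (t * x * Complex.I) ∂(nP μ σ)) := by
    refine hasSum_integral_of_dominated_convergence
      (fun n x => |f x| * (|t * x| ^ n / n.factorial)) ?_ ?_ ?_ ?_ ?_
    · intro n
      exact (Complex.continuous_ofReal.comp_aestronglyMeasurable hf.1).mul
        (by fun_prop)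
    · intro n
      refine ae_of_all _ fun x => ?_
      simp [abs_mul]
    · exact ae_of_all _ fun x => (Real.summable_pow_div_factorial _).mul_left _
    · have : (fun a => ∑' n : ℕ, |f a| * (|t * a| ^ n / n.factorial)) =
          fun a => |f a| * Real.exp |t * a| := by
        funext a
        rw [tsum_mul_left, Real.exp_eq_exp_ℝ, NormedSpace.exp_eq_tsum_div]
      rw [this]
      exact hf.abs.integrable_mul (exp_abs_memLp hσ t)
    · refine ae_of_all _ fun x => ?_
      have := NormedSpace.expSeries_div_hasSum_exp (t * x * Complex.I : ℂ)
      rw [← Complex.exp_eq_exp_ℂ] at this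
      exact this.mul_left _
  have hz : ∀ n : ℕ, ∫ x, (f x : ℂ) * (((t * x * Complex.I : ℂ)) ^ n / n.factorial)
      ∂(nP μ σ) = 0 := by
    intro n
    have : ∀ x : ℝ, (f x : ℂ) * (((t * x * Complex.I : ℂ)) ^ n / n.factorial) =
        ((t * Complex.I) ^ n / n.factorial) * ((f x * x ^ n : ℝ) : ℂ) := fun x => by
      push_cast; ring
    simp_rw [this]
    rw [integral_const_mul, integral_complex_ofReal, h0]
    simp
  simp_rw [hz] at hs
  exact hs.unique hasSum_zero

lemma complete (hσ : 0 < σ) {f : ℝ → ℝ} (hf : MemLp f 2 (nP μ σ))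
    (h0 : ∀ n : ℕ, ∫ x, f x * x ^ n ∂(nP μ σ) = 0) : f =ᵐ[nP μ σ] 0 := by
  have := nP_prob (μ := μ) hσ
  have hi : Integrable f (nP μ σ) := hf.integrable (by norm_num)
  have hm := hi.aemeasurable
  have fin1 : ∫⁻ x, ENNReal.ofReal (f x) ∂(nP μ σ) ≠ ⊤ := hi.lintegral_lt_top.ne
  have fin2 : ∫⁻ x, ENNReal.ofReal (-f x) ∂(nP μ σ) ≠ ⊤ := hi.neg.lintegral_lt_top.ne
  have f1 : IsFiniteMeasure ((nP μ σ).withDensity fun x => ENNReal.ofReal (f x)) :=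
    isFiniteMeasure_withDensity fin1
  have f2 : IsFiniteMeasure ((nP μ σ).withDensity fun x => ENNReal.ofReal (-f x)) :=
    isFiniteMeasure_withDensity fin2
  have heq : ((nP μ σ).withDensity fun x => ENNReal.ofReal (f x)) =
      ((nP μ σ).withDensity fun x => ENNReal.ofReal (-f x)) := by
    apply Measure.ext_of_charFun
    funext t
    rw [charFun_apply_real, charFun_apply_real,
      integral_withDensity_eq_integral_toReal_smul₀ hm.ennreal_ofReal (by simp),
      integral_withDensity_eq_integral_toReal_smul₀ hm.fun_neg.ennreal_ofReal (by simp),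
      ← sub_eq_zero]
    have nrm : ∀ x : ℝ, ‖Complex.exp (t * x * Complex.I)‖ ≤ 1 := fun x => by
      have := Complex.norm_exp_ofReal_mul_I (t * x)
      push_cast at this
      exact this.le
    have i1 : Integrable (fun x => (ENNReal.ofReal (f x)).toReal •
        Complex.exp (t * x * Complex.I)) (nP μ σ) :=
      (integrable_toReal_of_lintegral_ne_top hm.ennreal_ofReal fin1).smul_bdd 1
        (by fun_prop) (ae_of_all _ nrm)
    have i2 : Integrable (fun x => (ENNReal.ofReal (-f x)).toReal •
        Complex.exp (t * x * Complex.I)) (nP μ σ) :=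
      (integrable_toReal_of_lintegral_ne_top hm.fun_neg.ennreal_ofReal fin2).smul_bdd 1
        (by fun_prop) (ae_of_all _ nrm)
    refine Eq.trans (integral_sub i1 i2).symm ?_
    rw [← complete_aux hσ hf h0 t]
    congr 1
    funext x
    rw [← sub_smul, Complex.real_smul]
    congr 2
    simp only [ENNReal.toReal_ofReal']
    rcases le_total 0 (f x) with h | h
    · rw [max_eq_left h, max_eq_right (by linarith)]; ring
    · rw [max_eq_right h, max_eq_left (by linarith)]; ring
  rw [withDensity_eq_iff hm.ennreal_ofReal hm.fun_neg.ennreal_ofReal fin1] at heq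
  filter_upwards [heq] with x hx
  have := congrArg ENNReal.toReal hx
  simp only [ENNReal.toReal_ofReal'] at this
  rcases le_total 0 (f x) with h | h
  · rw [max_eq_left h, max_eq_right (by linarith)] at this; simpa using this
  · rw [max_eq_right h, max_eq_left (by linarith)] at this
    simp only [Pi.zero_apply]; linarith

lemma complete_HP (hσ : 0 < σ) {f : ℝ → ℝ} (hf : MemLp f 2 (nP μ σ))
    (h0 : ∀ n : ℕ, ∫ x, f x * (HP μ (σ ^ 2) n).eval x ∂(nP μ σ) = 0) : f =ᵐ[nP μ σ] 0 := by
  apply complete hσ hf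
  intro n
  have hi : ∀ p : Polynomial ℝ, Integrable (fun x => f x * p.eval x) (nP μ σ) := fun p =>
    hf.integrable_mul (nP_poly_memLp hσ p)
  have : ∀ q ∈ Submodule.span ℝ (Set.range (HP μ (σ ^ 2))),
      ∫ x, f x * q.eval x ∂(nP μ σ) = 0 := by
    intro q hq
    induction hq using Submodule.span_induction with
    | mem x hx => obtain ⟨k, rfl⟩ := hx; exact h0 k
    | zero => simp
    | add x y _ _ hx hy =>
      simp_rw [Polynomial.eval_add, mul_add]
      rw [integral_add (hi x) (hi y), hx, hy, add_zero]
    | smul a x _ hx =>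
      simp_rw [Polynomial.eval_smul, smul_eq_mul, mul_left_comm _ a]
      rw [integral_const_mul, hx, mul_zero]
  have h := this _ (HP_span μ (σ ^ 2) n)
  simpa using h

end herm

section final
variable {μ σ : ℝ}

lemma parseval (hσ : 0 < σ) {f : ℝ → ℝ} (hf : MemLp f 2 (nP μ σ)) :
    HasSum (fun k : ℕ => (∫ x, f x * (HP μ (σ ^ 2) k).eval x ∂(nP μ σ)) ^ 2 /
      ((σ ^ 2) ^ k * (k.factorial : ℝ))) (∫ x, f x ^ 2 ∂(nP μ σ)) := by
  set c : ℕ → ℝ := fun k => (σ ^ 2) ^ k * (k.factorial : ℝ) with hc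
  have hcpos : ∀ k, 0 < c k := fun k => by simp only [hc]; positivity
  set b : ℕ → Lp ℝ 2 (nP μ σ) := fun k =>
    (Real.sqrt (c k))⁻¹ • (nP_poly_memLp hσ (HP μ (σ ^ 2) k)).toLp _ with hb
  have hin : ∀ {u w : ℝ → ℝ} (hu : MemLp u 2 (nP μ σ)) (hw : MemLp w 2 (nP μ σ)),
      inner ℝ (hu.toLp u) (hw.toLp w) = ∫ x, u x * w x ∂(nP μ σ) := by
    intro u w hu hw
    rw [L2.inner_def]
    apply integral_congr_ae
    filter_upwards [hu.coeFn_toLp, hw.coeFn_toLp] with x h1 h2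
    rw [h1, h2]
    simp [mul_comm]
  have hon : Orthonormal ℝ b := by
    rw [orthonormal_iff_ite]
    intro i j
    simp only [hb]
    rw [real_inner_smul_left, real_inner_smul_right, hin, HP_orth hσ]
    by_cases h : i = j
    · subst h
      simp only [if_true]
      have h1 : Real.sqrt (c i) * Real.sqrt (c i) = c i := Real.mul_self_sqrt (hcpos i).le
      have h2 : Real.sqrt (c i) ≠ 0 := (Real.sqrt_pos.2 (hcpos i)).ne'
      change _ * (_ * c i) = 1
      generalize Real.sqrt (c i) = s at *
      rw [← h1]
      field_simp
    · simp [h]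
  have hsp : (Submodule.span ℝ (Set.range b))ᗮ = ⊥ := by
    rw [Submodule.eq_bot_iff]
    intro u hu
    rw [Submodule.mem_orthogonal] at hu
    have hu' : ∀ k, ∫ x, u x * (HP μ (σ ^ 2) k).eval x ∂(nP μ σ) = 0 := by
      intro k
      have h1 := hu (b k) (Submodule.subset_span ⟨k, rfl⟩)
      simp only [hb] at h1
      have hl : (Lp.memLp u).toLp u = u := Lp.toLp_coeFn u (Lp.memLp u)
      rw [← hl, real_inner_smul_left, hin] at h1
      have h2 : (Real.sqrt (c k))⁻¹ ≠ 0 := inv_ne_zero (Real.sqrt_pos.2 (hcpos k)).ne'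
      have h3 := (mul_eq_zero.1 h1).resolve_left h2
      rw [← h3]
      congr 1
      funext x
      ring
    rw [Lp.eq_zero_iff_ae_eq_zero]
    exact complete_HP hσ (Lp.memLp u) hu'
  set B := HilbertBasis.mkOfOrthogonalEqBot hon hsp with hB
  have hBb : ⇑B = b := HilbertBasis.coe_mkOfOrthogonalEqBot hon hsp
  have hs := B.hasSum_inner_mul_inner (hf.toLp f) (hf.toLp f)
  rw [hin hf hf] at hs
  have e2 : ∫ x, f x * f x ∂(nP μ σ) = ∫ x, f x ^ 2 ∂(nP μ σ) := by
    congr 1; funext x; ring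
  rw [e2] at hs
  refine hs.congr_fun ?_
  intro k
  rw [hBb, real_inner_comm (hf.toLp f) (b k)]
  simp only [hb]
  rw [real_inner_smul_right, hin hf]
  have h1 : Real.sqrt (c k) * Real.sqrt (c k) = c k := Real.mul_self_sqrt (hcpos k).le
  have h2 : Real.sqrt (c k) ≠ 0 := (Real.sqrt_pos.2 (hcpos k)).ne'
  change _ / c k = _
  generalize Real.sqrt (c k) = s at *
  rw [← h1]
  field_simp

lemma alt_choose (m n : ℕ) :
    ∑ k ∈ Finset.range (n + 1), (-1 : ℝ) ^ k * ((m + 1).choose k : ℝ) =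
      (-1) ^ n * (m.choose n : ℝ) := by
  induction n with
  | zero => simp
  | succ n ih =>
    rw [Finset.sum_range_succ, ih, Nat.choose_succ_succ]
    push_cast
    ring

theorem main_aux (hσ : 0 < σ) (n : ℕ) (gd : ℕ → ℝ → ℝ)
    (hac : ∀ k < n, ACd (gd k) (gd (k + 1))) (hL : ∀ k ≤ n, MemLp (gd k) 2 (nP μ σ)) :
    0 ≤ (-1 : ℝ) ^ n * (variance (gd 0) (nP μ σ) -
      ∑ k ∈ Finset.Icc 1 n,
        (-1 : ℝ) ^ (k - 1) * (σ ^ (2 * k) / (k.factorial : ℝ)) *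
          ∫ x, (gd k x) ^ 2 ∂(nP μ σ)) := by
  have := nP_prob (μ := μ) hσ
  set d : ℕ → ℝ := fun m => ∫ x, gd 0 x * (HP μ (σ ^ 2) m).eval x ∂(nP μ σ) with hd
  set a : ℕ → ℝ := fun m => d m ^ 2 / ((σ ^ 2) ^ m * (m.factorial : ℝ)) with ha
  have hapos : ∀ m, 0 ≤ a m := fun m => by simp only [ha]; positivity
  set Bk : ℕ → ℝ := fun k => σ ^ (2 * k) / (k.factorial : ℝ) * ∫ x, (gd k x) ^ 2 ∂(nP μ σ) with hBk
  have hcoef : ∀ k ≤ n, ∀ j, (σ ^ 2) ^ k * ∫ x, gd k x * (HP μ (σ ^ 2) j).eval x ∂(nP μ σ) =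
      d (j + k) := by
    intro k
    induction k with
    | zero => intro _ j; simp [hd]
    | succ k ih =>
      intro hk j
      have h1 := ih (by omega) (j + 1)
      rw [HP_step hσ (hac k (by omega)) (hL (k + 1) hk)] at h1
      rw [show j + (k + 1) = j + 1 + k by ring, ← h1]
      ring
  have hsum : ∀ k ≤ n, HasSum (fun m => a m * (m.choose k : ℝ)) (Bk k) := by
    intro k hk
    have h1 := (parseval hσ (hL k hk)).mul_left (σ ^ (2 * k) / (k.factorial : ℝ))
    have h2 : HasSum (fun j => a (j + k) * ((j + k).choose k : ℝ)) (Bk k) := by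
      refine h1.congr_fun ?_
      intro j
      simp only [ha]
      rw [← hcoef k hk j]
      have hf : ((j + k).choose k : ℝ) * (j.factorial : ℝ) * (k.factorial : ℝ) =
          ((j + k).factorial : ℝ) := by
        have := Nat.add_choose_mul_factorial_mul_factorial j k
        exact_mod_cast this
      rw [← hf]
      have hc : ((j + k).choose k : ℝ) ≠ 0 := by
        exact_mod_cast (Nat.choose_pos (Nat.le_add_left k j)).ne'
      have := hσ.ne'
      field_simp
      ring
    have h3 := (hasSum_nat_add_iff (f := fun m => a m * (m.choose k : ℝ)) k).1 h2
    have h4 : ∑ i ∈ Finset.range k, a i * (i.choose k : ℝ) = 0 := by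
      apply Finset.sum_eq_zero
      intro i hi
      rw [Nat.choose_eq_zero_of_lt (Finset.mem_range.1 hi)]; simp
    rwa [h4, add_zero] at h3
  have hvar : variance (gd 0) (nP μ σ) = Bk 0 - a 0 := by
    rw [variance_eq_sub (hL 0 (Nat.zero_le _))]
    simp [hBk, ha, hd, HP]
  have hS : ∑ k ∈ Finset.Icc 1 n,
        (-1 : ℝ) ^ (k - 1) * (σ ^ (2 * k) / (k.factorial : ℝ)) *
          ∫ x, (gd k x) ^ 2 ∂(nP μ σ) = Bk 0 - ∑ k ∈ Finset.range (n + 1), (-1) ^ k * Bk k := by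
    rw [Finset.sum_range_succ', ← Finset.Ico_add_one_right_eq_Icc, Finset.sum_Ico_eq_sum_range]
    simp only [Nat.add_sub_cancel, pow_zero, one_mul]
    rw [sub_add_cancel_right, ← Finset.sum_neg_distrib]
    refine Finset.sum_congr rfl fun k _ => ?_
    simp only [hBk]
    rw [show 1 + k - 1 = k by omega, add_comm 1 k]
    ring
  rw [hvar, hS]
  have t1 : HasSum (fun m => ∑ k ∈ Finset.range (n + 1), (-1 : ℝ) ^ k * (a m * (m.choose k : ℝ)))
      (∑ k ∈ Finset.range (n + 1), (-1) ^ k * Bk k) :=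
    hasSum_sum fun k hk => (hsum k (by have := Finset.mem_range.1 hk; omega)).mul_left _
  have t2 : HasSum (fun m : ℕ => if m = 0 then a 0 else 0) (a 0) := hasSum_ite_eq 0 (a 0)
  have t3 := (t1.sub t2).mul_left ((-1 : ℝ) ^ n)
  have e : (-1 : ℝ) ^ n * (Bk 0 - a 0 - (Bk 0 - ∑ k ∈ Finset.range (n + 1), (-1) ^ k * Bk k)) =
      (-1) ^ n * (∑ k ∈ Finset.range (n + 1), (-1) ^ k * Bk k - a 0) := by ring
  rw [e]
  refine t3.nonneg fun m => ?_
  cases m with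
  | zero =>
    rw [Finset.sum_range_succ']
    simp
  | succ m =>
    simp only [Nat.succ_ne_zero, if_false, sub_zero, Nat.add_eq_zero_iff, one_ne_zero, and_false]
    simp_rw [mul_left_comm _ (a (m + 1))]
    rw [← Finset.mul_sum, alt_choose, mul_left_comm, ← mul_assoc ((-1 : ℝ) ^ n), ← mul_pow]
    simpa using mul_nonneg (hapos (m + 1)) (Nat.cast_nonneg (α := ℝ) (m.choose n))

end final

/-- **Johnson's Poincaré-type bound for the normal distribution.**
For `X ∼ N(μ, σ²)`, `n ≥ 1` and suitable `g`,
`(−1)^n (Var g(X) − Σ_{k=1}^{n} (−1)^{k−1} (σ^{2k}/k!) E (g^{(k)}(X))²) ≥ 0`. -/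
theorem normal_poincare_bound
    (μ σ : ℝ) (hσ : 0 < σ) (P : Measure ℝ)
    (hP : P = volume.withDensity (fun x => ENNReal.ofReal (normalDensity μ σ x)))
    (n : ℕ) (hn : 1 ≤ n) (gd : ℕ → ℝ → ℝ)
    (hg : MemH P (fun _ => 1) Set.univ 0 n gd) :
    0 ≤ (-1 : ℝ) ^ n * (variance (gd 0) P -
      ∑ k ∈ Finset.Icc 1 n,
        (-1 : ℝ) ^ (k - 1) * (σ ^ (2 * k) / (k.factorial : ℝ)) *
          ∫ x, (gd k x) ^ 2 ∂P) := by
  have hP' : P = nP μ σ := hP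
  subst hP'
  obtain ⟨h1, h2, h3, h4, -⟩ := hg
  have hmax : max 0 n = n := by simp
  rw [hmax] at h1 h2 h3
  have hcont : ∀ k < n, Continuous (gd k) := by
    intro k hk
    by_cases h : k + 1 < n
    · exact continuous_iff_continuousAt.2 fun x => (h1 k h x trivial).continuousAt
    · have : k = n - 1 := by omega
      rw [this]
      exact continuousOn_univ.1 (h2 hn)
  have hac : ∀ k < n, ACd (gd k) (gd (k + 1)) := by
    intro k hk a b
    by_cases h : k + 1 < n
    · have hi := (hcont (k + 1) h).intervalIntegrable (μ := volume) a b
      exact ⟨hi, (intervalIntegral.integral_eq_sub_of_hasDerivAt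
        (fun x _ => h1 k h x trivial) hi).symm⟩
    · have hk' : k = n - 1 := by omega
      have hk2 : k + 1 = n := by omega
      rw [hk2, hk']
      exact h3 hn a trivial b trivial
  have hLn : MemLp (gd n) 2 (nP μ σ) := by
    have h := hac (n - 1) (by omega)
    rw [Nat.sub_add_cancel hn] at h
    exact h.memLp' (by simpa using h4)
  have hL : ∀ k ≤ n, MemLp (gd k) 2 (nP μ σ) := by
    intro k hk
    induction hk using Nat.decreasingInduction with
    | self => exact hLn
    | of_succ k hk ih => exact (hac k (by omega)).memLp hσ ih
  exact main_aux hσ n gd hac hL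

end
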